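/- For every interface 𝕀 and all processes p and q: p ⊑^𝕀_unc q implies p ⊑^𝕀_ind q; that is, the individualistic must preorder is coarser than the uncoordinated must preorder. -/

import Mathlib

/-!
Common definitions: sequential CCS with success, configurations,
must testing, Mazurkiewicz traces, filtered traces, interfaces, and
the classical / uncoordinated / individualistic must preorders.
-/

namespace MultipartyTesting

/-- Actions: input or output over a name. -/
inductive Act (Name : Type) : Type where
  | inp : Name → Act Name
  | out : Name → Act Name

/-- Complementation of actions (involutive). -/
def Act.co {Name : Type} : Act Name → Act Name
  | .inp a => .out a
  | .out a => .inp a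

/-- Transition labels: visible actions, the internal action τ, and success ✓. -/
inductive Label (Name : Type) : Type where
  | act : Act Name → Label Name
  | tau : Label Name
  | tick : Label Name

/-- Sequential CCS with success (recursion via de Bruijn indices):
`p ::= 0 | 1 | μ.p | p+q | X | rec_X. p` where prefixes are actions (`pre`) or τ (`tpre`). -/
inductive Proc (Name : Type) : Type where
  | nil : Proc Name
  | one : Proc Name
  | pre : Act Name → Proc Name → Proc Name
  | tpre : Proc Name → Proc Name
  | choice : Proc Name → Proc Name → Proc Name
  | var : ℕ → Proc Name
  | fix : Proc Name → Proc Name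

namespace Proc

variable {Name : Type}

/-- de Bruijn lifting. -/
def lift (d : ℕ) : Proc Name → Proc Name
  | nil => nil
  | one => one
  | pre a p => pre a (lift d p)
  | tpre p => tpre (lift d p)
  | choice p q => choice (lift d p) (lift d q)
  | var k => if k < d then var k else var (k + 1)
  | fix p => fix (lift (d + 1) p)

/-- Substitution of `u` for de Bruijn index `d`. -/
def subst (d : ℕ) (u : Proc Name) : Proc Name → Proc Name
  | nil => nil
  | one => one
  | pre a p => pre a (subst d u p)
  | tpre p => tpre (subst d u p)
  | choice p q => choice (subst d u p) (subst d u q)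
  | var k => if k = d then u else if k < d then var k else var (k - 1)
  | fix p => fix (subst (d + 1) (lift 0 u) p)

/-- The set of actions occurring in a process (so `α` or `ᾱ` occurs in `p`
iff the corresponding name is in `n(p)`). -/
def acts : Proc Name → Set (Act Name)
  | nil => ∅
  | one => ∅
  | pre a p => insert a (acts p)
  | tpre p => acts p
  | choice p q => acts p ∪ acts q
  | var _ => ∅
  | fix p => acts p

end Proc

/-- The LTS on sequential processes. -/
inductive Step {Name : Type} : Proc Name → Label Name → Proc Name → Prop where
  | one : Step Proc.one Label.tick Proc.nil
  | pre (a : Act Name) (p : Proc Name) : Step (Proc.pre a p) (Label.act a) p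
  | tpre (p : Proc Name) : Step (Proc.tpre p) Label.tau p
  | choiceL {p l p'} (q) : Step p l p' → Step (Proc.choice p q) l p'
  | choiceR {q l q'} (p) : Step q l q' → Step (Proc.choice p q) l q'
  | fix {p l p'} : Step (Proc.subst 0 (Proc.fix p) p) l p' → Step (Proc.fix p) l p'

/-- Configurations: parallel compositions of processes; additionally
`hide V c` is the projection `c↾V` that hides (turns into τ) every action not in `V`. -/
inductive Conf (Name : Type) : Type where
  | proc : Proc Name → Conf Name
  | par : Conf Name → Conf Name → Conf Name
  | hide : Set (Act Name) → Conf Name → Conf Name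

/-- Pure configurations: parallel compositions of processes (no hiding),
i.e. the configurations of the paper. -/
inductive Conf.Pure {Name : Type} : Conf Name → Prop where
  | proc (p : Proc Name) : Pure (Conf.proc p)
  | par {c d} : Pure c → Pure d → Pure (Conf.par c d)

/-- The LTS on configurations: interleaving of non-✓ labels, synchronization of
complementary actions into τ, simultaneous ✓, and the projection rules. -/
inductive CStep {Name : Type} : Conf Name → Label Name → Conf Name → Prop where
  | proc {p l p'} : Step p l p' → CStep (Conf.proc p) l (Conf.proc p')
  | parL {c l c'} (d) : CStep c l c' → l ≠ Label.tick →
      CStep (Conf.par c d) l (Conf.par c' d)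
  | parR {d l d'} (c) : CStep d l d' → l ≠ Label.tick →
      CStep (Conf.par c d) l (Conf.par c d')
  | sync {c a c' d d'} : CStep c (Label.act a) c' → CStep d (Label.act (Act.co a)) d' →
      CStep (Conf.par c d) Label.tau (Conf.par c' d')
  | tick {c c' d d'} : CStep c Label.tick c' → CStep d Label.tick d' →
      CStep (Conf.par c d) Label.tick (Conf.par c' d')
  | hideV {V : Set (Act Name)} {c a c'} : CStep c (Label.act a) c' → a ∈ V →
      CStep (Conf.hide V c) (Label.act a) (Conf.hide V c')
  | hideH {V : Set (Act Name)} {c a c'} : CStep c (Label.act a) c' → a ∉ V →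
      CStep (Conf.hide V c) Label.tau (Conf.hide V c')
  | hideT {V : Set (Act Name)} {c c'} : CStep c Label.tau c' →
      CStep (Conf.hide V c) Label.tau (Conf.hide V c')

variable {Name : Type}

/-- Weak internal transitions `c ⇒ c'`. -/
def WTau : Conf Name → Conf Name → Prop :=
  Relation.ReflTransGen (fun c c' => CStep c Label.tau c')

/-- Weak visible transition `c ⇒^a c'`. -/
def WAct (c : Conf Name) (a : Act Name) (c' : Conf Name) : Prop :=
  ∃ c₁ c₂, WTau c c₁ ∧ CStep c₁ (Label.act a) c₂ ∧ WTau c₂ c'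

/-- Weak string transition `c ⇒^s c'` for `s ∈ Act*`. -/
inductive WString : Conf Name → List (Act Name) → Conf Name → Prop where
  | nil {c c'} : WTau c c' → WString c [] c'
  | cons {c a c₁ s c'} : WAct c a c₁ → WString c₁ s c' → WString c (a :: s) c'

/-- Traces of a configuration (restricted to strings over `Act`). -/
def Tr (c : Conf Name) : Set (List (Act Name)) := {s | ∃ c', WString c s c'}

/-- Divergence: an infinite sequence of τ-transitions. -/
def Div (c : Conf Name) : Prop :=
  ∃ f : ℕ → Conf Name, f 0 = c ∧ ∀ n, CStep (f n) Label.tau (f (n + 1))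

/-- Convergence. -/
def Conv (c : Conf Name) : Prop := ¬ Div c

/-- Convergence along a string: `c ⇓ s`. -/
def ConvS : Conf Name → List (Act Name) → Prop
  | c, [] => Conv c
  | c, a :: s => Conv c ∧ ∀ c', WAct c a c' → ConvS c' s

/-- `c MUST L`. -/
def MUSTone (c : Conf Name) (L : Set (Act Name)) : Prop :=
  ∀ c', WTau c c' → ∃ a ∈ L, ∃ c'', WAct c' a c''

/-- `P MUST L` for a set of configurations. -/
def MUSTset (P : Set (Conf Name)) (L : Set (Act Name)) : Prop :=
  ∀ c ∈ P, MUSTone c L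

/-- Residuals: `(c after s)`. -/
def after (c : Conf Name) (s : List (Act Name)) : Set (Conf Name) :=
  {c' | WString c s c'}

/-- `c must o`: every maximal τ-computation of `c ‖ o` (tracked componentwise)
contains a state whose observer component has a ✓-transition. -/
def MustPass (c o : Conf Name) : Prop :=
  ∀ cs os : ℕ → Conf Name, cs 0 = c → os 0 = o →
    ((∀ k, CStep (Conf.par (cs k) (os k)) Label.tau (Conf.par (cs (k + 1)) (os (k + 1)))) →
       ∃ j, ∃ o', CStep (os j) Label.tick o') ∧
    (∀ n : ℕ,
       (∀ k < n, CStep (Conf.par (cs k) (os k)) Label.tau (Conf.par (cs (k + 1)) (os (k + 1)))) →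
       (¬ ∃ d, CStep (Conf.par (cs n) (os n)) Label.tau d) →
       ∃ j ≤ n, ∃ o', CStep (os j) Label.tick o')

/-- The classical must preorder `p ⊑_must q` (observers are all configurations
of the paper, i.e. pure configurations). -/
def MustLeq (p q : Proc Name) : Prop :=
  ∀ o : Conf Name, o.Pure → MustPass (Conf.proc p) o → MustPass (Conf.proc q) o

/-- An interface: a partition `{I_i}_{i ∈ 0..n}` of `Act` closed under complementation. -/
structure Interface (Name : Type) (n : ℕ) where
  part : Fin (n + 1) → Set (Act Name)
  cover : ∀ a, ∃ i, a ∈ part i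
  disjoint : ∀ i j, i ≠ j → ∀ a, a ∈ part i → a ∉ part j
  nonempty : ∀ i, (part i).Nonempty
  coClosed : ∀ i a, a ∈ part i → Act.co a ∈ part i

/-- `o₀ ‖ o₁ ‖ … ‖ o_n` as a configuration. -/
def parOfList (p : Proc Name) : List (Proc Name) → Conf Name
  | [] => Conf.proc p
  | q :: qs => Conf.par (Conf.proc p) (parOfList q qs)

/-- The parallel composition of an indexed family of processes. -/
def parComp {n : ℕ} (os : Fin (n + 1) → Proc Name) : Conf Name :=
  parOfList (os 0) (List.ofFn fun i : Fin n => os i.succ)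

/-- The uncoordinated must preorder `p ⊑^𝕀_unc q`. -/
def UncLeq {n : ℕ} (𝕀 : Interface Name n) (p q : Proc Name) : Prop :=
  ∀ os : Fin (n + 1) → Proc Name, (∀ i, Proc.acts (os i) ⊆ 𝕀.part i) →
    MustPass (Conf.proc p) (parComp os) → MustPass (Conf.proc q) (parComp os)

/-- The individualistic must preorder `p ⊑^𝕀_ind q`. -/
def IndLeq {n : ℕ} (𝕀 : Interface Name n) (p q : Proc Name) : Prop :=
  ∀ os : Fin (n + 1) → Proc Name, (∀ i, Proc.acts (os i) ⊆ 𝕀.part i) →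
    ∀ i, MustPass (Conf.hide (𝕀.part i) (Conf.proc p)) (Conf.proc (os i)) →
         MustPass (Conf.hide (𝕀.part i) (Conf.proc q)) (Conf.proc (os i))

/-- One swap of adjacent independent actions (w.r.t. a dependency relation `D`). -/
inductive SwapStep (D : Set (Act Name × Act Name)) :
    List (Act Name) → List (Act Name) → Prop where
  | swap (u v : List (Act Name)) (a b : Act Name) :
      (a, b) ∉ D → SwapStep D (u ++ a :: b :: v) (u ++ b :: a :: v)

/-- Mazurkiewicz trace equivalence `≡_D`: the least congruence on `Act*`
with `αβ ≡ βα` whenever `(α,β) ∉ D`. -/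
def MEquiv (D : Set (Act Name × Act Name)) : List (Act Name) → List (Act Name) → Prop :=
  Relation.EqvGen (SwapStep D)

/-- The dependency relation induced by an interface: `D = ∪_{I∈𝕀} I×I`. -/
def DepOf {n : ℕ} (𝕀 : Interface Name n) : Set (Act Name × Act Name) :=
  {x | ∃ i, x.1 ∈ 𝕀.part i ∧ x.2 ∈ 𝕀.part i}

/-- `c ⇓ [s]_D`. -/
def ConvMC (c : Conf Name) (D : Set (Act Name × Act Name)) (s : List (Act Name)) : Prop :=
  ∀ t, MEquiv D s t → ConvS c t

/-- `(c after [s]_D)`. -/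
def afterMC (c : Conf Name) (D : Set (Act Name × Act Name)) (s : List (Act Name)) :
    Set (Conf Name) :=
  {c' | ∃ t, MEquiv D s t ∧ WString c t c'}

/-- The trace-based characterisation `p ≼^𝕀 q` of the uncoordinated preorder. -/
def TraceLeqUnc {n : ℕ} (𝕀 : Interface Name n) (p q : Proc Name) : Prop :=
  ∀ (s : List (Act Name)) (i : Fin (n + 1)) (L : Set (Act Name)),
    L.Finite → L ⊆ 𝕀.part i → ConvMC (Conf.proc p) (DepOf 𝕀) s →
      ConvMC (Conf.proc q) (DepOf 𝕀) s ∧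
      (MUSTset (afterMC (Conf.proc p) (DepOf 𝕀) s) L →
       MUSTset (afterMC (Conf.proc q) (DepOf 𝕀) s) L)

open Classical in
/-- `s↾I`: the subsequence of `s` consisting of its symbols in `I`. -/
noncomputable def fproj (I : Set (Act Name)) (s : List (Act Name)) : List (Act Name) :=
  s.filter fun a => decide (a ∈ I)

/-- `c ⇓ ⟨s⟩_I`. -/
def ConvFC (c : Conf Name) (I : Set (Act Name)) (s : List (Act Name)) : Prop :=
  ∀ t, fproj I t = fproj I s → ConvS c t

/-- `(c after ⟨s⟩_I)`. -/
def afterFC (c : Conf Name) (I : Set (Act Name)) (s : List (Act Name)) :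
    Set (Conf Name) :=
  {c' | ∃ t, fproj I t = fproj I s ∧ WString c t c'}

/-- The filtered-trace characterisation `p ≼^𝕀_flt q` of the individualistic preorder. -/
def TraceLeqInd {n : ℕ} (𝕀 : Interface Name n) (p q : Proc Name) : Prop :=
  ∀ (i : Fin (n + 1)) (s : List (Act Name)), (∀ a ∈ s, a ∈ 𝕀.part i) →
    ∀ L : Set (Act Name), L.Finite → L ⊆ 𝕀.part i →
      ConvFC (Conf.proc p) (𝕀.part i) s →
        ConvFC (Conf.proc q) (𝕀.part i) s ∧
        (MUSTset (afterFC (Conf.proc p) (𝕀.part i) s) (L ∪ (𝕀.part i)ᶜ) →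
         MUSTset (afterFC (Conf.proc q) (𝕀.part i) s) (L ∪ (𝕀.part i)ᶜ))

/-- A configuration is unsuccessful if it has no ✓-transition. -/
def Unsucc (c : Conf Name) : Prop := ¬ ∃ c', CStep c Label.tick c'

/-- Unsuccessful weak internal transitions: all states passed through are unsuccessful. -/
inductive UTau : Conf Name → Conf Name → Prop where
  | refl {c} : Unsucc c → UTau c c
  | step {c c₁ c'} : Unsucc c → CStep c Label.tau c₁ → UTau c₁ c' → UTau c c'

/-- Unsuccessful weak visible transition. -/
def UWAct (c : Conf Name) (a : Act Name) (c' : Conf Name) : Prop :=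
  ∃ c₁ c₂, UTau c c₁ ∧ CStep c₁ (Label.act a) c₂ ∧ UTau c₂ c'

/-- Unsuccessful weak string transition (an unsuccessful weak computation `c ⇒^s c'`). -/
inductive UWString : Conf Name → List (Act Name) → Conf Name → Prop where
  | nil {c c'} : UTau c c' → UWString c [] c'
  | cons {c a c₁ s c'} : UWAct c a c₁ → UWString c₁ s c' → UWString c (a :: s) c'


theorem Proc.acts_lift (d : ℕ) (p : Proc Name) : (p.lift d).acts = p.acts := by
  induction p generalizing d with
  | var k => simp only [Proc.lift]; split <;> rfl
  | _ => simp_all [Proc.lift, Proc.acts]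

theorem Proc.acts_subst (d : ℕ) (u p : Proc Name) :
    (Proc.subst d u p).acts ⊆ p.acts ∪ u.acts := by
  induction p generalizing d u with
  | nil => simp [Proc.subst, Proc.acts]
  | one => simp [Proc.subst, Proc.acts]
  | pre a p ih =>
    intro x hx
    have := @ih d u x
    simp only [Proc.subst, Proc.acts, Set.mem_insert_iff, Set.mem_union] at *
    tauto
  | tpre p ih => exact ih d u
  | choice p q ihp ihq =>
    intro x hx
    have h₁ := @ihp d u x
    have h₂ := @ihq d u x
    simp only [Proc.subst, Proc.acts, Set.mem_union] at *
    tauto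
  | var k =>
    simp only [Proc.subst]
    split
    · exact Set.subset_union_right
    · split <;> simp [Proc.acts]
  | fix p ih =>
    have := ih (d + 1) (u.lift 0)
    rwa [Proc.acts_lift] at this

theorem Proc.acts_finite (p : Proc Name) : p.acts.Finite := by
  induction p with
  | pre a p ih => exact ih.insert a
  | tpre p ih => exact ih
  | choice p q ihp ihq => exact ihp.union ihq
  | fix p ih => exact ih
  | _ => exact Set.finite_empty

theorem Act.co_co (a : Act Name) : a.co.co = a := by cases a <;> rfl

theorem Step.acts_subset {p p' : Proc Name} {l : Label Name} (h : Step p l p') :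
    p'.acts ⊆ p.acts := by
  induction h with
  | one => exact subset_rfl
  | pre a p => exact Set.subset_insert _ _
  | tpre p => exact subset_rfl
  | choiceL q _ ih => exact ih.trans Set.subset_union_left
  | choiceR p _ ih => exact ih.trans Set.subset_union_right
  | fix _ ih => exact ih.trans ((Proc.acts_subst _ _ _).trans (Set.union_self _).subset)

theorem Step.act_mem_acts {p p' : Proc Name} {a : Act Name} (h : Step p (.act a) p') :
    a ∈ p.acts := by
  generalize hl : Label.act a = l at h
  induction h with
  | one => cases hl
  | pre b p => cases hl; exact Set.mem_insert _ _
  | tpre p => cases hl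
  | choiceL q _ ih => exact Or.inl (ih hl)
  | choiceR p _ ih => exact Or.inr (ih hl)
  | fix _ ih => exact (Proc.acts_subst _ _ _ (ih hl)).elim id id

/-- `✓ + Σ_{a ∈ l} a.q`. -/
def menu (q : Proc Name) : List (Act Name) → Proc Name
  | [] => .one
  | a :: l => .choice (.pre a q) (menu q l)

theorem subst_menu (d : ℕ) (u q : Proc Name) (l : List (Act Name)) :
    Proc.subst d u (menu q l) = menu (Proc.subst d u q) l := by
  induction l with
  | nil => rfl
  | cons a l ih => simp [menu, Proc.subst, ih]

theorem acts_menu_subset (q : Proc Name) (l : List (Act Name)) :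
    (menu q l).acts ⊆ {a | a ∈ l} ∪ q.acts := by
  induction l with
  | nil => simp [menu, Proc.acts]
  | cons b l ih =>
    intro x hx
    have := @ih x
    simp only [menu, Proc.acts, Set.mem_insert_iff, Set.mem_union, Set.mem_ofPred_eq,
      List.mem_cons] at *
    tauto

theorem step_menu_iff {q r : Proc Name} {l : List (Act Name)} {μ : Label Name} :
    Step (menu q l) μ r ↔ (μ = .tick ∧ r = .nil) ∨ ∃ a ∈ l, μ = .act a ∧ r = q := by
  induction l with
  | nil =>
    constructor
    · intro h; cases h; simp
    · rintro (⟨rfl, rfl⟩ | ⟨a, h, -⟩)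
      · exact .one
      · cases h
  | cons b l ih =>
    constructor
    · intro h
      cases h with
      | choiceL _ h => cases h; exact Or.inr ⟨b, by simp, rfl, rfl⟩
      | choiceR _ h =>
        rcases ih.1 h with h | ⟨a, ha, h⟩
        · exact Or.inl h
        · exact Or.inr ⟨a, by simp [ha], h⟩
    · rintro (h | ⟨a, ha, rfl, rfl⟩)
      · exact .choiceR _ (ih.2 (Or.inl h))
      · rcases List.mem_cons.1 ha with rfl | ha
        · exact .choiceL _ (.pre _ _)
        · exact .choiceR _ (ih.2 (Or.inr ⟨a, ha, rfl, rfl⟩))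

/-- The observer `rec X. (✓ + Σ_{a ∈ l} a.X)`, always successful and always offering the
actions of `l`. -/
def server (l : List (Act Name)) : Proc Name := .fix (menu (.var 0) l)

theorem acts_server_subset (l : List (Act Name)) : (server l).acts ⊆ {a | a ∈ l} := by
  simpa [server, Proc.acts] using acts_menu_subset (.var 0) l

theorem step_server_iff {r : Proc Name} {l : List (Act Name)} {μ : Label Name} :
    Step (server l) μ r ↔
      (μ = .tick ∧ r = .nil) ∨ ∃ a ∈ l, μ = .act a ∧ r = server l := by
  have : Proc.subst 0 (server l) (menu (.var 0) l) = menu (server l) l := by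
    rw [subst_menu]; simp [Proc.subst]
  rw [← step_menu_iff, ← this]
  exact ⟨fun h => by cases h; assumption, .fix⟩

theorem cstep_proc_iff {p : Proc Name} {l : Label Name} {d : Conf Name} :
    CStep (.proc p) l d ↔ ∃ p', Step p l p' ∧ d = .proc p' := by
  constructor
  · intro h; cases h; exact ⟨_, by assumption, rfl⟩
  · rintro ⟨p', h, rfl⟩; exact .proc h

theorem parComp_zero (os : Fin 1 → Proc Name) : parComp os = .proc (os 0) := rfl

theorem parComp_succ {n : ℕ} (os : Fin (n + 2) → Proc Name) :
    parComp os = .par (.proc (os 0)) (parComp (Fin.tail os)) := by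
  simp [parComp, parOfList, List.ofFn_succ, Fin.tail]

theorem parComp_update_zero {n : ℕ} (os : Fin (n + 2) → Proc Name) (x : Proc Name) :
    parComp (Function.update os 0 x) = .par (.proc x) (parComp (Fin.tail os)) := by
  rw [parComp_succ, Fin.tail_update_zero]; simp

theorem parComp_update_succ {n : ℕ} (os : Fin (n + 2) → Proc Name) (j : Fin (n + 1))
    (x : Proc Name) :
    parComp (Function.update os j.succ x) =
      .par (.proc (os 0)) (parComp (Function.update (Fin.tail os) j x)) := by
  rw [parComp_succ, Fin.tail_update_succ, Function.update_of_ne (Fin.succ_ne_zero j).symm]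

theorem cstep_parComp_of_step {n : ℕ} {os : Fin (n + 1) → Proc Name} {j : Fin (n + 1)}
    {l : Label Name} {o' : Proc Name} (h : Step (os j) l o') (hl : l ≠ .tick) :
    CStep (parComp os) l (parComp (Function.update os j o')) := by
  induction n with
  | zero =>
    obtain rfl : j = 0 := Subsingleton.elim (α := Fin 1) _ _
    simpa [parComp_zero] using CStep.proc h
  | succ n ih =>
    rw [parComp_succ os]
    cases j using Fin.cases with
    | zero => rw [parComp_update_zero]; exact .parL _ (.proc h) hl
    | succ j => rw [parComp_update_succ]; exact .parR _ (ih (os := Fin.tail os) h) hl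

theorem cstep_parComp_act {n : ℕ} {os : Fin (n + 1) → Proc Name} {a : Act Name} {d : Conf Name}
    (h : CStep (parComp os) (.act a) d) :
    ∃ j o', Step (os j) (.act a) o' ∧ d = parComp (Function.update os j o') := by
  induction n generalizing d with
  | zero =>
    obtain ⟨o', ht, rfl⟩ := cstep_proc_iff.1 h
    exact ⟨0, o', ht, by simp [parComp_zero]⟩
  | succ n ih =>
    rw [parComp_succ] at h
    cases h with
    | parL _ h =>
      obtain ⟨o', ht, rfl⟩ := cstep_proc_iff.1 h
      exact ⟨0, o', ht, (parComp_update_zero _ _).symm⟩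
    | parR _ h =>
      obtain ⟨j, o', ht, rfl⟩ := ih h
      exact ⟨j.succ, o', ht, (parComp_update_succ _ _ _).symm⟩

theorem cstep_parComp_tau {n : ℕ} {os : Fin (n + 1) → Proc Name} {d : Conf Name}
    (hos : ∀ j k, j ≠ k → ∀ a ∈ (os j).acts, a.co ∉ (os k).acts)
    (h : CStep (parComp os) .tau d) :
    ∃ j o', Step (os j) .tau o' ∧ d = parComp (Function.update os j o') := by
  induction n generalizing d with
  | zero =>
    obtain ⟨o', ht, rfl⟩ := cstep_proc_iff.1 h
    exact ⟨0, o', ht, by simp [parComp_zero]⟩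
  | succ n ih =>
    rw [parComp_succ] at h
    cases h with
    | parL _ h =>
      obtain ⟨o', ht, rfl⟩ := cstep_proc_iff.1 h
      exact ⟨0, o', ht, (parComp_update_zero _ _).symm⟩
    | parR _ h =>
      obtain ⟨j, o', ht, rfl⟩ :=
        ih (fun j k hjk => hos j.succ k.succ fun e => hjk (Fin.succ_injective _ e)) h
      exact ⟨j.succ, o', ht, (parComp_update_succ _ _ _).symm⟩
    | sync h₁ h₂ =>
      obtain ⟨o', ht₁, rfl⟩ := cstep_proc_iff.1 h₁
      obtain ⟨j, o', ht₂, rfl⟩ := cstep_parComp_act h₂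
      exact absurd ht₂.act_mem_acts
        (hos 0 j.succ (Fin.succ_ne_zero j).symm _ ht₁.act_mem_acts)

theorem cstep_parComp_tick_iff {n : ℕ} {os : Fin (n + 1) → Proc Name} :
    (∃ d, CStep (parComp os) .tick d) ↔ ∀ j, ∃ o', Step (os j) .tick o' := by
  induction n with
  | zero => simp [parComp_zero, cstep_proc_iff, Fin.forall_fin_one]
  | succ n ih =>
    rw [parComp_succ, Fin.forall_fin_succ]
    refine Iff.trans ?_ (and_congr_right' (ih (os := Fin.tail os)))
    constructor
    · rintro ⟨d, h⟩
      cases h with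
      | parL _ _ h => exact absurd rfl h
      | parR _ _ h => exact absurd rfl h
      | tick h₁ h₂ =>
        obtain ⟨o', h₁, -⟩ := cstep_proc_iff.1 h₁
        exact ⟨⟨o', h₁⟩, _, h₂⟩
    · rintro ⟨⟨o', h₁⟩, d, h₂⟩
      exact ⟨_, .tick (.proc h₁) h₂⟩

/-- Must testing is transported backwards along simulations that reflect deadlock and success. -/
theorem MustPass.of_simulation {R : Conf Name × Conf Name → Conf Name × Conf Name → Prop}
    (hstep : ∀ x y, R x y → ∀ z : Conf Name × Conf Name,
      CStep (.par y.1 y.2) .tau (.par z.1 z.2) →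
        ∃ w : Conf Name × Conf Name, CStep (.par x.1 x.2) .tau (.par w.1 w.2) ∧ R w z)
    (hstuck : ∀ x y, R x y → (∃ d, CStep (.par x.1 x.2) .tau d) →
      ∃ d, CStep (.par y.1 y.2) .tau d)
    (htick : ∀ x y, R x y → (∃ d, CStep x.2 .tick d) → ∃ d, CStep y.2 .tick d)
    {c o c' o' : Conf Name} (hR : R (c, o) (c', o')) (h : MustPass c o) : MustPass c' o' := by
  intro cs os hc ho
  choose! f hf using hstep
  let g : ℕ → Conf Name × Conf Name := fun n =>
    Nat.rec (c, o) (fun k x => f x (cs k, os k) (cs (k + 1), os (k + 1))) n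
  have key : ∀ n,
      (∀ k < n, CStep (.par (cs k) (os k)) .tau (.par (cs (k + 1)) (os (k + 1)))) →
      R (g n) (cs n, os n) ∧
        ∀ k < n, CStep (.par (g k).1 (g k).2) .tau (.par (g (k + 1)).1 (g (k + 1)).2) := by
    intro n
    induction n with
    | zero => intro _; subst hc ho; exact ⟨hR, by simp⟩
    | succ n ih =>
      intro hs
      obtain ⟨hRn, hn⟩ := ih fun k hk => hs k (hk.trans n.lt_succ_self)
      have hw := hf _ _ hRn (cs (n + 1), os (n + 1)) (hs n n.lt_succ_self)
      refine ⟨hw.2, fun k hk => ?_⟩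
      rcases Nat.lt_succ_iff_lt_or_eq.1 hk with hk | rfl
      · exact hn k hk
      · exact hw.1
  obtain ⟨hinf, hfin⟩ := h (fun n => (g n).1) (fun n => (g n).2) rfl rfl
  refine ⟨fun hs => ?_, fun n hs hst => ?_⟩
  · obtain ⟨j, hj⟩ := hinf fun k => (key (k + 1) fun k _ => hs k).2 k k.lt_succ_self
    exact ⟨j, htick _ _ (key j fun k _ => hs k).1 hj⟩
  · obtain ⟨hRn, hn⟩ := key n hs
    obtain ⟨j, hjn, hj⟩ := hfin n hn fun hd => hst (hstuck _ _ hRn hd)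
    exact ⟨j, hjn, htick _ _ (key j fun k hk => hs k (hk.trans_le hjn)).1 hj⟩

/-- The joint internal steps of `p↾V` and a sequential observer. -/
def HideStep (V : Set (Act Name)) (p o p' o' : Proc Name) : Prop :=
  (Step p .tau p' ∧ o' = o) ∨ (∃ a ∉ V, Step p (.act a) p' ∧ o' = o) ∨
    (p' = p ∧ Step o .tau o') ∨ ∃ a ∈ V, Step p (.act a) p' ∧ Step o (.act a.co) o'

theorem cstep_hide_par_iff {V : Set (Act Name)} {p o : Proc Name} {d : Conf Name} :
    CStep (.par (.hide V (.proc p)) (.proc o)) .tau d ↔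
      ∃ p' o', d = .par (.hide V (.proc p')) (.proc o') ∧ HideStep V p o p' o' := by
  constructor
  · intro h
    cases h with
    | parL _ h =>
      cases h with
      | hideH h ha =>
        obtain ⟨p', ht, rfl⟩ := cstep_proc_iff.1 h
        exact ⟨p', o, rfl, .inr (.inl ⟨_, ha, ht, rfl⟩)⟩
      | hideT h =>
        obtain ⟨p', ht, rfl⟩ := cstep_proc_iff.1 h
        exact ⟨p', o, rfl, .inl ⟨ht, rfl⟩⟩
    | parR _ h =>
      obtain ⟨o', ht, rfl⟩ := cstep_proc_iff.1 h
      exact ⟨p, o', rfl, .inr (.inr (.inl ⟨rfl, ht⟩))⟩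
    | sync h₁ h₂ =>
      cases h₁ with
      | hideV h₁ ha =>
        obtain ⟨p', ht₁, rfl⟩ := cstep_proc_iff.1 h₁
        obtain ⟨o', ht₂, rfl⟩ := cstep_proc_iff.1 h₂
        exact ⟨p', o', rfl, .inr (.inr (.inr ⟨_, ha, ht₁, ht₂⟩))⟩
  · rintro ⟨p', o', rfl, ⟨h, rfl⟩ | ⟨a, ha, h, rfl⟩ | ⟨rfl, h⟩ | ⟨a, ha, h₁, h₂⟩⟩
    · exact .parL _ (.hideT (.proc h)) (by simp)
    · exact .parL _ (.hideH (.proc h) ha) (by simp)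
    · exact .parR _ (.proc h) (by simp)
    · exact .sync (.hideV (.proc h₁) ha) (.proc h₂)

section Servers

variable {n : ℕ} {𝕀 : Interface Name n} (l : Fin (n + 1) → List (Act Name)) (i : Fin (n + 1))

/-- The observer `o` in position `i`, with servers in all other positions. -/
def withServers (o : Proc Name) : Fin (n + 1) → Proc Name :=
  Function.update (fun j => server (l j)) i o

variable {l i}

@[simp] theorem withServers_self (o : Proc Name) : withServers l i o i = o := by
  simp [withServers]

theorem withServers_of_ne (o : Proc Name) {j : Fin (n + 1)} (h : j ≠ i) :
    withServers l i o j = server (l j) := by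
  simp [withServers, h]

theorem update_withServers_self (o o' : Proc Name) :
    Function.update (withServers l i o) i o' = withServers l i o' := by
  simp [withServers]

theorem update_withServers_of_ne (o : Proc Name) {j : Fin (n + 1)} (h : j ≠ i) :
    Function.update (withServers l i o) j (server (l j)) = withServers l i o := by
  rw [← withServers_of_ne o h, Function.update_eq_self]

theorem acts_withServers_subset (hl : ∀ j, ∀ a ∈ l j, a ∈ 𝕀.part j) {o : Proc Name}
    (ho : o.acts ⊆ 𝕀.part i) (j : Fin (n + 1)) : (withServers l i o j).acts ⊆ 𝕀.part j := by
  by_cases h : j = i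
  · subst h; simpa using ho
  · rw [withServers_of_ne o h]
    exact (acts_server_subset _).trans (hl j)

theorem cstep_par_withServers_iff (hl : ∀ j, ∀ a ∈ l j, a ∈ 𝕀.part j) {p o : Proc Name}
    (ho : o.acts ⊆ 𝕀.part i) (hp : ∀ j, ∀ a ∈ p.acts, a ∈ 𝕀.part j → a.co ∈ l j)
    {d : Conf Name} :
    CStep (.par (.proc p) (parComp (withServers l i o))) .tau d ↔
      ∃ p' o', d = .par (.proc p') (parComp (withServers l i o')) ∧
        HideStep (𝕀.part i) p o p' o' := by
  have hos := acts_withServers_subset hl ho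
  constructor
  · intro h
    cases h with
    | parL _ h =>
      obtain ⟨p', ht, rfl⟩ := cstep_proc_iff.1 h
      exact ⟨p', o, rfl, .inl ⟨ht, rfl⟩⟩
    | parR _ h =>
      obtain ⟨j, o', ht, rfl⟩ := cstep_parComp_tau (fun j k hjk a ha hk =>
        𝕀.disjoint j k hjk _ (𝕀.coClosed _ _ (hos j ha)) (hos k hk)) h
      by_cases hj : j = i
      · subst hj
        rw [withServers_self] at ht
        exact ⟨p, o', by rw [update_withServers_self], .inr (.inr (.inl ⟨rfl, ht⟩))⟩
      · rw [withServers_of_ne o hj, step_server_iff] at ht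
        simp at ht
    | @sync _ a _ _ _ h₁ h₂ =>
      obtain ⟨p', ht₁, rfl⟩ := cstep_proc_iff.1 h₁
      obtain ⟨j, o', ht₂, rfl⟩ := cstep_parComp_act h₂
      have ha : a ∈ 𝕀.part j := by
        simpa [Act.co_co] using 𝕀.coClosed _ _ (hos j ht₂.act_mem_acts)
      by_cases hj : j = i
      · subst hj
        rw [withServers_self] at ht₂
        exact ⟨p', o', by rw [update_withServers_self], .inr (.inr (.inr ⟨a, ha, ht₁, ht₂⟩))⟩
      · rw [withServers_of_ne o hj, step_server_iff] at ht₂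
        obtain ⟨h, -⟩ | ⟨b, -, -, rfl⟩ := ht₂
        · cases h
        · exact ⟨p', o, by rw [update_withServers_of_ne o hj],
            .inr (.inl ⟨a, 𝕀.disjoint j i hj a ha, ht₁, rfl⟩)⟩
  · rintro ⟨p', o', rfl, ⟨h, rfl⟩ | ⟨a, ha, h, rfl⟩ | ⟨rfl, h⟩ | ⟨a, ha, h₁, h₂⟩⟩
    · exact .parL _ (.proc h) (by simp)
    · obtain ⟨j, hj⟩ := 𝕀.cover a
      have hji : j ≠ i := by rintro rfl; exact ha hj
      have hs : Step (withServers l i o' j) (.act a.co) (server (l j)) := by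
        rw [withServers_of_ne _ hji, step_server_iff]
        exact .inr ⟨_, hp j a h.act_mem_acts hj, rfl, rfl⟩
      have := cstep_parComp_of_step hs (by simp)
      rw [update_withServers_of_ne _ hji] at this
      exact .sync (.proc h) this
    · have := cstep_parComp_of_step (os := withServers l i o) (j := i) (o' := o')
        (l := .tau) (by simpa using h) (by simp)
      rw [update_withServers_self] at this
      exact .parR _ this (by simp)
    · have := cstep_parComp_of_step (os := withServers l i o) (j := i) (o' := o')
        (l := .act a.co) (by simpa using h₂) (by simp)
      rw [update_withServers_self] at this
      exact .sync (.proc h₁) this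

theorem tick_withServers_iff {o : Proc Name} :
    (∃ d, CStep (parComp (withServers l i o)) .tick d) ↔ ∃ d, CStep (.proc o) .tick d := by
  have ho : (∃ d, CStep (.proc o) .tick d) ↔ ∃ o', Step o .tick o' := by
    simp [cstep_proc_iff]
  rw [cstep_parComp_tick_iff, ho]
  refine ⟨fun h => by simpa using h i, fun h j => ?_⟩
  by_cases hj : j = i
  · subst hj; simpa using h
  · rw [withServers_of_ne o hj]
    exact ⟨_, step_server_iff.2 (.inl ⟨rfl, rfl⟩)⟩

theorem HideStep.acts_subset {V : Set (Act Name)} {p o p' o' : Proc Name}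
    (h : HideStep V p o p' o') : p'.acts ⊆ p.acts ∧ o'.acts ⊆ o.acts := by
  rcases h with ⟨h, rfl⟩ | ⟨a, ha, h, rfl⟩ | ⟨rfl, h⟩ | ⟨a, ha, h₁, h₂⟩
  · exact ⟨h.acts_subset, subset_rfl⟩
  · exact ⟨h.acts_subset, subset_rfl⟩
  · exact ⟨subset_rfl, h.acts_subset⟩
  · exact ⟨h₁.acts_subset, h₂.acts_subset⟩

/-- Servers in the other positions have the same effect as hiding their parts. -/
theorem mustPass_withServers_iff (hl : ∀ j, ∀ a ∈ l j, a ∈ 𝕀.part j) {p o : Proc Name}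
    (ho : o.acts ⊆ 𝕀.part i) (hp : ∀ j, ∀ a ∈ p.acts, a ∈ 𝕀.part j → a.co ∈ l j) :
    MustPass (.proc p) (parComp (withServers l i o)) ↔
      MustPass (.hide (𝕀.part i) (.proc p)) (.proc o) := by
  let R : Conf Name × Conf Name → Conf Name × Conf Name → Prop := fun x y =>
    ∃ p o : Proc Name, o.acts ⊆ 𝕀.part i ∧
      (∀ j, ∀ a ∈ p.acts, a ∈ 𝕀.part j → a.co ∈ l j) ∧
      x = (.proc p, parComp (withServers l i o)) ∧
      y = (.hide (𝕀.part i) (.proc p), .proc o)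
  have hR : ∀ {p o p' o' : Proc Name}, o.acts ⊆ 𝕀.part i →
      (∀ j, ∀ a ∈ p.acts, a ∈ 𝕀.part j → a.co ∈ l j) → HideStep (𝕀.part i) p o p' o' →
      R (.proc p', parComp (withServers l i o')) (.hide (𝕀.part i) (.proc p'), .proc o') :=
    fun ho hp h => ⟨_, _, h.acts_subset.2.trans ho,
      fun j a ha => hp j a (h.acts_subset.1 ha), rfl, rfl⟩
  constructor
  · refine MustPass.of_simulation (R := R) ?_ ?_ ?_ ⟨p, o, ho, hp, rfl, rfl⟩
    · rintro _ _ ⟨p, o, ho, hp, rfl, rfl⟩ ⟨z₁, z₂⟩ h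
      obtain ⟨p', o', e, ht⟩ := cstep_hide_par_iff.1 h
      cases e
      exact ⟨_, (cstep_par_withServers_iff hl ho hp).2 ⟨p', o', rfl, ht⟩, hR ho hp ht⟩
    · rintro _ _ ⟨p, o, ho, hp, rfl, rfl⟩ ⟨d, h⟩
      obtain ⟨p', o', -, ht⟩ := (cstep_par_withServers_iff hl ho hp).1 h
      exact ⟨_, cstep_hide_par_iff.2 ⟨p', o', rfl, ht⟩⟩
    · rintro _ _ ⟨p, o, ho, hp, rfl, rfl⟩ h
      exact tick_withServers_iff.1 h
  · refine MustPass.of_simulation (R := fun x y => R y x) ?_ ?_ ?_ ⟨p, o, ho, hp, rfl, rfl⟩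
    · rintro _ _ ⟨p, o, ho, hp, rfl, rfl⟩ ⟨z₁, z₂⟩ h
      obtain ⟨p', o', e, ht⟩ := (cstep_par_withServers_iff hl ho hp).1 h
      cases e
      exact ⟨_, cstep_hide_par_iff.2 ⟨p', o', rfl, ht⟩, hR ho hp ht⟩
    · rintro _ _ ⟨p, o, ho, hp, rfl, rfl⟩ ⟨d, h⟩
      obtain ⟨p', o', -, ht⟩ := cstep_hide_par_iff.1 h
      exact ⟨_, (cstep_par_withServers_iff hl ho hp).2 ⟨p', o', rfl, ht⟩⟩
    · rintro _ _ ⟨p, o, ho, hp, rfl, rfl⟩ h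
      exact tick_withServers_iff.2 h

end Servers

/-- the individualistic preorder is coarser than the uncoordinated
one: `p ⊑^𝕀_unc q` implies `p ⊑^𝕀_ind q`. -/
theorem uncLeq_implies_indLeq (Name : Type) [Countable Name] {n : ℕ}
    (𝕀 : Interface Name n) (p q : Proc Name) (h : UncLeq 𝕀 p q) :
    IndLeq 𝕀 p q := by
  intro os hos i hp
  have hfin : ∀ j, ∃ l : List (Act Name),
      ∀ a, a ∈ l ↔ a ∈ Act.co '' (p.acts ∪ q.acts) ∩ 𝕀.part j := by
    intro j
    have hf := ((p.acts_finite.union q.acts_finite).image Act.co).inter_of_left (𝕀.part j)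
    exact ⟨hf.toFinset.toList, by simp⟩
  choose l hl using hfin
  have hlI : ∀ j, ∀ a ∈ l j, a ∈ 𝕀.part j := fun j a ha => ((hl j a).1 ha).2
  have hlco : ∀ a ∈ p.acts ∪ q.acts, ∀ j, a ∈ 𝕀.part j → a.co ∈ l j := fun a ha j hj =>
    (hl j _).2 ⟨Set.mem_image_of_mem _ ha, 𝕀.coClosed j a hj⟩
  have hq := h (withServers l i (os i)) (acts_withServers_subset hlI (hos i))
    ((mustPass_withServers_iff hlI (hos i) fun j a ha => hlco a (.inl ha) j).2 hp)
  exact (mustPass_withServers_iff hlI (hos i) fun j a ha => hlco a (.inr ha) j).1 hq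

end MultipartyTesting
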